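/- Fix an integer t with 3 ≤ t ≤ O(1), an arity k ≤ O(1), U ≤ C·√n, a failure probability 0 < p < 1/2, and parameters ζ ≤ 1/2, SMALL ≤ n; set ζ' = (k+1)ζ. Form a random factor graph with n variable-vertices and Δn constraint-vertices of arity k, each choosing a uniformly random scope of k distinct variables and carrying a (t−1)-wise uniform distribution (so t_h = t); add two deterministic sets of constraints with pairwise disjoint scopes whose scopes partition [n]: a set M₁ of at most U unary constraints carrying 0-wise uniform distributions (t_h = 1), and a set M₂ of arity-2 matching constraints carrying 1-wise uniform distributions (t_h = 2). Then there is a universal constant κ₀ > 0 such that if Δ ≤ κ₀ · p · (n/SMALL)^{t/2 − 1 − ζ'}, then with probability at least 1 − p, every nonempty constraint-induced subgraph H with c(H) ≤ SMALL satisfies v(H) ≥ e(H) − T(H)/2 + ζ·c(H). -/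

import Mathlib

open Finset

/-- Probability of an event under the uniform distribution on a finite sample space. -/
noncomputable def uprob {Ω : Type} [Fintype Ω] (p : Ω → Prop) : ℝ :=
  letI := Classical.decPred p
  ((Finset.univ.filter p).card : ℝ) / (Fintype.card Ω : ℝ)

section Partition

variable {V : Type*} [Fintype V] [DecidableEq V]

/-- Unary scopes `M₁` and binary scopes `M₂` that cover `V` with total size `|V|` partition `V`, so
sums over `V` split along the scopes. -/
lemma sum_scopes_eq_sum_univ (M₁ : Finset V) (M₂ : Finset (V × V))
    (hcover : (M₁ ∪ M₂.biUnion fun e => {e.1, e.2}) = univ)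
    (hcard : M₁.card + 2 * M₂.card = Fintype.card V) (f : V → ℝ) :
    ∑ v ∈ M₁, f v + ∑ e ∈ M₂, (f e.1 + f e.2) = ∑ v, f v := by
  set mult : V → ℕ := fun v =>
    (if v ∈ M₁ then 1 else 0) +
      ∑ e ∈ M₂, ((if e.1 = v then 1 else 0) + (if e.2 = v then 1 else 0)) with hmult
  have one_le : ∀ v ∈ (univ : Finset V), 1 ≤ mult v := by
    intro v _
    have hv : v ∈ M₁ ∪ M₂.biUnion fun e => {e.1, e.2} := hcover ▸ mem_univ v
    simp only [mem_union, mem_biUnion, mem_insert, mem_singleton] at hv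
    rcases hv with hv | ⟨e, he, hv⟩
    · simp [hmult, hv]
    · have := single_le_sum (f := fun e : V × V =>
        ((if e.1 = v then 1 else 0) + (if e.2 = v then 1 else 0) : ℕ))
        (fun _ _ => Nat.zero_le _) he
      have h1 : 1 ≤ ((if e.1 = v then 1 else 0) + (if e.2 = v then 1 else 0) : ℕ) := by
        rcases hv with hv | hv <;> simp [← hv]
      simp only [hmult]
      omega
  have sum_mult : ∑ v, mult v = ∑ _v : V, 1 := by
    simp only [hmult, sum_add_distrib]
    rw [sum_comm (s := univ), sum_comm (s := univ)]
    simp [sum_ite_eq]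
    omega
  have mult_eq : ∀ v, mult v = 1 := fun v =>
    (((sum_eq_sum_iff_of_le one_le).1 sum_mult.symm) v (mem_univ v)).symm
  calc ∑ v ∈ M₁, f v + ∑ e ∈ M₂, (f e.1 + f e.2)
      = ∑ v, (mult v : ℝ) * f v := by
        simp only [hmult, Nat.cast_add, Nat.cast_sum, Nat.cast_ite, Nat.cast_one, Nat.cast_zero,
          add_mul, sum_mul, sum_add_distrib]
        rw [sum_comm (s := univ), sum_comm (s := univ)]
        simp [ite_mul]
    _ = ∑ v, f v := by simp [mult_eq]

/-- The number of variables of `W`, discounting by half those in unary scopes and counting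
binary scopes only once. -/
noncomputable def scopeWeight (M₁ : Finset V) (M₂ : Finset (V × V)) (W : Finset V) : ℝ :=
  ∑ v ∈ M₁, (if v ∈ W then 1 / 2 else 0) +
    ∑ e ∈ M₂, (if e.1 ∈ W ∨ e.2 ∈ W then 1 else 0)

/-- Adding unary and binary constraints to a set `W` of variables gains at most the difference
between `|W|` and its weight, up to `ζ` per constraint. -/
lemma scopeWeight_le (M₁ : Finset V) (M₂ : Finset (V × V))
    (hcover : (M₁ ∪ M₂.biUnion fun e => {e.1, e.2}) = univ)
    (hcard : M₁.card + 2 * M₂.card = Fintype.card V)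
    (W C₁ : Finset V) (C₂ : Finset (V × V)) (h₁ : C₁ ⊆ M₁) (h₂ : C₂ ⊆ M₂)
    (ζ : ℝ) (hζ : 0 ≤ ζ) (hζ' : ζ ≤ 1 / 2) :
    scopeWeight M₁ M₂ W - ζ * W.card ≤
      ((W ∪ C₁ ∪ C₂.biUnion fun e => {e.1, e.2}).card : ℝ)
        - (1 / 2 + ζ) * C₁.card - (1 + ζ) * C₂.card := by
  set X := W ∪ C₁ ∪ C₂.biUnion fun e => {e.1, e.2} with hX
  have card_eq : ∀ Y : Finset V, (Y.card : ℝ) =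
      ∑ v ∈ M₁, (if v ∈ Y then 1 else 0) +
        ∑ e ∈ M₂, ((if e.1 ∈ Y then 1 else 0) + (if e.2 ∈ Y then 1 else 0)) := by
    intro Y
    rw [sum_scopes_eq_sum_univ M₁ M₂ hcover hcard (fun v => if v ∈ Y then (1 : ℝ) else 0)]
    simp
  have card_C₁ : (C₁.card : ℝ) = ∑ v ∈ M₁, (if v ∈ C₁ then 1 else 0) := by
    rw [sum_ite_mem, inter_eq_right.2 h₁]; simp
  have card_C₂ : (C₂.card : ℝ) = ∑ e ∈ M₂, (if e ∈ C₂ then 1 else 0) := by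
    rw [sum_ite_mem, inter_eq_right.2 h₂]; simp
  rw [card_eq W, card_eq X, card_C₁, card_C₂, scopeWeight]
  have unary : ∑ v ∈ M₁, ((if v ∈ W then (1 / 2 : ℝ) else 0) - ζ * (if v ∈ W then 1 else 0)) ≤
      ∑ v ∈ M₁, ((if v ∈ X then (1 : ℝ) else 0) - (1 / 2 + ζ) * (if v ∈ C₁ then 1 else 0)) := by
    refine sum_le_sum fun v _ => ?_
    have hW : v ∈ W → v ∈ X := fun h => by simp [hX, h]
    have hC : v ∈ C₁ → v ∈ X := fun h => by simp [hX, h]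
    split_ifs <;> first | (exfalso; tauto) | linarith
  have binary : ∑ e ∈ M₂, ((if e.1 ∈ W ∨ e.2 ∈ W then (1 : ℝ) else 0) -
        ζ * ((if e.1 ∈ W then 1 else 0) + (if e.2 ∈ W then 1 else 0))) ≤
      ∑ e ∈ M₂, (((if e.1 ∈ X then (1 : ℝ) else 0) + (if e.2 ∈ X then 1 else 0)) -
        (1 + ζ) * (if e ∈ C₂ then 1 else 0)) := by
    refine sum_le_sum fun e _ => ?_
    have hW₁ : e.1 ∈ W → e.1 ∈ X := fun h => by simp [hX, h]
    have hW₂ : e.2 ∈ W → e.2 ∈ X := fun h => by simp [hX, h]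
    have hC : e ∈ C₂ → e.1 ∈ X ∧ e.2 ∈ X := fun h => by
      simp only [hX, mem_union, mem_biUnion, mem_insert, mem_singleton]
      exact ⟨Or.inr ⟨e, h, Or.inl rfl⟩, Or.inr ⟨e, h, Or.inr rfl⟩⟩
    clear_value X
    by_cases he : e ∈ C₂ <;> by_cases h₁ : e.1 ∈ W <;> by_cases h₂ : e.2 ∈ W <;>
      simp only [he, h₁, h₂, hW₁, hW₂, hC, or_self, or_true, true_or, if_true, if_false]
    all_goals first | linarith | (split_ifs <;> linarith)
  simp only [sum_sub_distrib, ← mul_sum] at unary binary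
  linarith

/-- The generating function of `scopeWeight` is bounded by a product over the scopes. -/
lemma sum_rpow_scopeWeight_le (M₁ : Finset V) (M₂ : Finset (V × V))
    (hcover : (M₁ ∪ M₂.biUnion fun e => {e.1, e.2}) = univ) (x : ℝ) (hx : 0 < x) :
    ∑ W : Finset V, x ^ scopeWeight M₁ M₂ W ≤
      (1 + √x) ^ M₁.card * (1 + 3 * x) ^ M₂.card := by
  classical
  let q : Bool × Bool → ℝ := fun b => if b.1 ∨ b.2 then x else 1
  let restrict : Finset V → (M₁ → Bool) × (M₂ → Bool × Bool) := fun W =>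
    (fun v => decide (v.1 ∈ W), fun e => (decide (e.1.1 ∈ W), decide (e.1.2 ∈ W)))
  let weight : (M₁ → Bool) × (M₂ → Bool × Bool) → ℝ := fun g =>
    (∏ v, if g.1 v then √x else 1) * ∏ e, q (g.2 e)
  have weight_nonneg : ∀ g, 0 ≤ weight g := fun g =>
    mul_nonneg (prod_nonneg fun v _ => by split_ifs <;> positivity)
      (prod_nonneg fun e _ => by simp only [q]; split_ifs <;> positivity)
  have restrict_injective : Function.Injective restrict := by
    intro W W' h
    simp only [restrict, Prod.mk.injEq, funext_iff, decide_eq_decide, Subtype.forall] at h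
    ext v
    have hv : v ∈ M₁ ∪ M₂.biUnion fun e => {e.1, e.2} := hcover ▸ mem_univ v
    simp only [mem_union, mem_biUnion, mem_insert, mem_singleton] at hv
    rcases hv with hv | ⟨e, he, rfl | rfl⟩
    · exact h.1 v hv
    · exact (h.2 e he).1
    · exact (h.2 e he).2
  have rpow_eq : ∀ W, x ^ scopeWeight M₁ M₂ W = weight (restrict W) := by
    intro W
    rw [scopeWeight, Real.rpow_add hx, Real.rpow_sum_of_pos hx, Real.rpow_sum_of_pos hx,
      ← prod_coe_sort M₁, ← prod_coe_sort M₂]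
    simp only [weight, restrict, q, decide_eq_true_eq]
    congr 1
    · refine prod_congr rfl fun v _ => ?_
      split_ifs
      · rw [Real.sqrt_eq_rpow]
      · simp
    · refine prod_congr rfl fun e _ => ?_
      split_ifs <;> simp
  calc ∑ W : Finset V, x ^ scopeWeight M₁ M₂ W
      = ∑ W, weight (restrict W) := sum_congr rfl fun W _ => rpow_eq W
    _ = ∑ g ∈ univ.map ⟨restrict, restrict_injective⟩, weight g := by rw [sum_map]; rfl
    _ ≤ ∑ g, weight g :=
        sum_le_sum_of_subset_of_nonneg (subset_univ _) fun g _ _ => weight_nonneg g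
    _ = (∑ g : M₁ → Bool, ∏ v, if g v then √x else 1) *
          ∑ g : M₂ → Bool × Bool, ∏ e, q (g e) := by
        rw [Fintype.sum_mul_sum, Fintype.sum_prod_type]
    _ = (1 + √x) ^ M₁.card * (1 + 3 * x) ^ M₂.card := by
        rw [← Fintype.prod_sum (fun (_ : M₁) (b : Bool) => if b then √x else 1),
          ← Fintype.prod_sum (fun (_ : M₂) b => q b)]
        simp only [prod_const, card_univ, Fintype.card_coe, Fintype.sum_prod_type,
          Fintype.sum_bool, q]
        simp
        ring

end Partition

/-- A random injection lands in a set of `w` out of `n` points with probability at most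
`(w / n) ^ k`. -/
lemma descFactorial_le_div_pow_mul (w n k : ℕ) (hwn : w ≤ n) (hn : 0 < n) :
    (w.descFactorial k : ℝ) ≤ ((w : ℝ) / n) ^ k * n.descFactorial k := by
  have hn' : (0 : ℝ) < n := by exact_mod_cast hn
  induction k with
  | zero => simp
  | succ k ih =>
    rw [Nat.descFactorial_succ, Nat.descFactorial_succ, pow_succ]
    push_cast
    have hstep : ((w - k : ℕ) : ℝ) ≤ (w : ℝ) / n * ((n - k : ℕ) : ℝ) := by
      rcases le_total w k with h | h
      · rw [Nat.sub_eq_zero_of_le h]; simp only [Nat.cast_zero]; positivity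
      · rw [Nat.cast_sub h, Nat.cast_sub (h.trans hwn), div_mul_eq_mul_div, le_div_iff₀ hn']
        have : (w : ℝ) ≤ n := by exact_mod_cast hwn
        nlinarith [(Nat.cast_nonneg k : (0 : ℝ) ≤ k)]
    calc ((w - k : ℕ) : ℝ) * (w.descFactorial k : ℝ)
        ≤ ((w : ℝ) / n * ((n - k : ℕ) : ℝ)) * (((w : ℝ) / n) ^ k * n.descFactorial k) := by
          gcongr
      _ = _ := by ring

/-- The number of tuples of scopes whose members indexed by `S` all lie in `W`. -/
lemma card_filter_scopes_subset_le (m n k : ℕ) (hn : 0 < n)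
    (S : Finset (Fin m)) (W : Finset (Fin n)) :
    ((univ.filter fun ω : Fin m → (Fin k ↪ Fin n) => ∀ j ∈ S, ∀ i, ω j i ∈ W).card : ℝ) ≤
      ((W.card : ℝ) / n) ^ (k * S.card) * Fintype.card (Fin m → (Fin k ↪ Fin n)) := by
  classical
  have card_into : (univ.filter fun f : Fin k ↪ Fin n => ∀ i, f i ∈ W).card =
      W.card.descFactorial k := by
    rw [← Fintype.card_subtype]
    have := Fintype.card_embedding_eq (α := Fin k) (β := W)
    rw [Fintype.card_fin, Fintype.card_coe] at this
    rw [← this]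
    exact Fintype.card_congr (Equiv.codRestrict (Fin k) (· ∈ W))
  have filter_eq : (univ.filter fun ω : Fin m → (Fin k ↪ Fin n) => ∀ j ∈ S, ∀ i, ω j i ∈ W) =
      Fintype.piFinset fun j => univ.filter fun f : Fin k ↪ Fin n => j ∈ S → ∀ i, f i ∈ W := by
    ext ω; simp
  have card_factor : ∀ j, ((univ.filter fun f : Fin k ↪ Fin n => j ∈ S → ∀ i, f i ∈ W).card : ℝ) ≤
      (if j ∈ S then ((W.card : ℝ) / n) ^ k else 1) * n.descFactorial k := by
    intro j
    by_cases hj : j ∈ S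
    · simp only [hj, true_imp_iff, if_true, card_into]
      exact descFactorial_le_div_pow_mul _ _ _ (by simpa using card_le_univ W) hn
    · simp [hj, Fintype.card_embedding_eq]
  rw [filter_eq, Fintype.card_piFinset, Nat.cast_prod]
  calc _ ≤ ∏ j, (if j ∈ S then ((W.card : ℝ) / n) ^ k else 1) * (n.descFactorial k : ℝ) :=
        prod_le_prod (fun _ _ => Nat.cast_nonneg _) fun j _ => card_factor j
    _ = _ := by
        rw [prod_mul_distrib, prod_ite_mem, univ_inter, prod_const, ← pow_mul, prod_const]
        simp [Fintype.card_embedding_eq]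

lemma choose_le_exp_mul_div_pow (m r : ℕ) (hr : 0 < r) :
    (m.choose r : ℝ) ≤ (Real.exp 1 * (m / r)) ^ r := by
  have hr' : (0 : ℝ) < r := by exact_mod_cast hr
  have hexp := Real.pow_div_factorial_le_exp (r : ℝ) hr'.le r
  calc (m.choose r : ℝ) ≤ (m : ℝ) ^ r / r.factorial := Nat.choose_le_pow_div r m
    _ = ((r : ℝ) ^ r / r.factorial) * ((m : ℝ) / r) ^ r := by
        rw [div_pow]; field_simp
    _ ≤ Real.exp r * ((m : ℝ) / r) ^ r := by gcongr
    _ = _ := by rw [mul_pow, ← Real.exp_nat_mul, mul_one]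

lemma density_mul_rpow_le (n SMALL r : ℕ) (Δ : ℕ) (c γ : ℝ) (hc₀ : 0 ≤ c) (hc : c < 1)
    (hr : 0 < r) (hrS : r ≤ SMALL) (hSn : SMALL ≤ n)
    (hΔ : (Δ : ℝ) ≤ c * ((n : ℝ) / SMALL) ^ γ) :
    (Δ : ℝ) * ((r : ℝ) / n) ^ γ ≤ c := by
  have hr' : (0 : ℝ) < r := by exact_mod_cast hr
  have hS' : (0 : ℝ) < SMALL := by exact_mod_cast hr.trans_le hrS
  have hn' : (0 : ℝ) < n := by exact_mod_cast (hr.trans_le hrS).trans_le hSn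
  rcases le_total 0 γ with hγ | hγ
  · have hle : ((r : ℝ) / SMALL) ^ γ ≤ 1 :=
      Real.rpow_le_one (by positivity) ((div_le_one hS').2 (by exact_mod_cast hrS)) hγ
    calc (Δ : ℝ) * ((r : ℝ) / n) ^ γ
        ≤ c * ((n : ℝ) / SMALL) ^ γ * ((r : ℝ) / n) ^ γ := by gcongr
      _ = c * ((r : ℝ) / SMALL) ^ γ := by
          rw [mul_assoc, ← Real.mul_rpow (by positivity) (by positivity)]
          congr 2; field_simp
      _ ≤ c := mul_le_of_le_one_right hc₀ hle
  · have hle : ((n : ℝ) / SMALL) ^ γ ≤ 1 :=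
      Real.rpow_le_one_of_one_le_of_nonpos ((one_le_div hS').2 (by exact_mod_cast hSn)) hγ
    have hΔ1 : (Δ : ℝ) < 1 := (hΔ.trans (mul_le_of_le_one_right hc₀ hle)).trans_lt hc
    have : Δ = 0 := by
      have : Δ < 1 := by exact_mod_cast hΔ1
      omega
    simpa [this] using hc₀

/-- First-moment bound on the number of outcomes in which some `r` random scopes lie in a small
variable set of weight at most `(k - t / 2 + ζ') r`. -/
lemma sum_card_filter_scopes_subset_le (t k n Δ r : ℕ) (Cu ζ' c : ℝ) (hCu : 0 ≤ Cu)
    (M₁ : Finset (Fin n)) (M₂ : Finset (Fin n × Fin n))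
    (hM₁ : (M₁.card : ℝ) ≤ Cu * √(n : ℝ))
    (hcover : (M₁ ∪ M₂.biUnion fun e => {e.1, e.2}) = univ)
    (hcard : M₁.card + 2 * M₂.card = n)
    (hr : 0 < r) (hrn : r ≤ n)
    (hΔ : (Δ : ℝ) * ((r : ℝ) / n) ^ ((t : ℝ) / 2 - 1 - ζ') ≤ c) :
    ∑ S ∈ powersetCard r (univ : Finset (Fin (Δ * n))),
      ∑ W ∈ univ.filter fun W : Finset (Fin n) =>
        W.card ≤ k * r ∧ scopeWeight M₁ M₂ W ≤ ((k : ℝ) - t / 2 + ζ') * r,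
      ((univ.filter fun ω : Fin (Δ * n) → (Fin k ↪ Fin n) =>
        ∀ j ∈ S, ∀ i, ω j i ∈ W).card : ℝ) ≤
    (k ^ k * Real.exp (4 + Cu) * c) ^ r * Fintype.card (Fin (Δ * n) → (Fin k ↪ Fin n)) := by
  have hn : 0 < n := hr.trans_le hrn
  have hr' : (0 : ℝ) < r := by exact_mod_cast hr
  have hn' : (0 : ℝ) < n := by exact_mod_cast hn
  set N : ℝ := (Fintype.card (Fin (Δ * n) → (Fin k ↪ Fin n)) : ℝ)
  have hN₀ : 0 ≤ N := Nat.cast_nonneg _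
  set β : ℝ := (k : ℝ) - t / 2 + ζ' with hβ
  set x : ℝ := (r : ℝ) / n with hx_def
  have hx : 0 < x := by positivity
  have hx1 : x ≤ 1 := (div_le_one hn').2 (by exact_mod_cast hrn)
  have hxn : x * n = r := by rw [hx_def]; field_simp
  have weight_sum : ∑ W : Finset (Fin n), x ^ scopeWeight M₁ M₂ W ≤ Real.exp (3 + Cu) ^ r := by
    refine (sum_rpow_scopeWeight_le M₁ M₂ hcover x hx).trans ?_
    have unary : (1 + √x) ^ M₁.card ≤ Real.exp Cu ^ r := by
      calc (1 + √x) ^ M₁.card ≤ Real.exp (√x) ^ M₁.card := by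
            gcongr; linarith [Real.add_one_le_exp (√x)]
        _ = Real.exp (M₁.card * √x) := by rw [Real.exp_nat_mul]
        _ ≤ Real.exp (r * Cu) := by
            apply Real.exp_le_exp.2
            have hsqrt : √(n : ℝ) * √x = √(r : ℝ) := by
              rw [← Real.sqrt_mul hn'.le, mul_comm, hxn]
            have hsqrt_le : √(r : ℝ) ≤ r := by
              rw [Real.sqrt_le_left hr'.le]
              have : (1 : ℝ) ≤ r := by exact_mod_cast hr
              nlinarith
            calc (M₁.card : ℝ) * √x ≤ Cu * √(n : ℝ) * √x := by gcongr
              _ = Cu * √(r : ℝ) := by rw [mul_assoc, hsqrt]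
              _ ≤ r * Cu := by rw [mul_comm]; gcongr
        _ = Real.exp Cu ^ r := by rw [Real.exp_nat_mul]
    have binary : (1 + 3 * x) ^ M₂.card ≤ Real.exp 3 ^ r := by
      calc (1 + 3 * x) ^ M₂.card ≤ Real.exp (3 * x) ^ M₂.card := by
            gcongr; linarith [Real.add_one_le_exp (3 * x)]
        _ = Real.exp (M₂.card * (3 * x)) := by rw [Real.exp_nat_mul]
        _ ≤ Real.exp (r * 3) := by
            apply Real.exp_le_exp.2
            have : (M₂.card : ℝ) ≤ n := by exact_mod_cast (by omega : M₂.card ≤ n)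
            nlinarith
        _ = Real.exp 3 ^ r := by rw [Real.exp_nat_mul]
    calc _ ≤ Real.exp Cu ^ r * Real.exp 3 ^ r := by gcongr
      _ = Real.exp (3 + Cu) ^ r := by rw [← mul_pow, ← Real.exp_add, add_comm]
  have inner : ∀ S ∈ powersetCard r (univ : Finset (Fin (Δ * n))),
      ∑ W ∈ univ.filter fun W : Finset (Fin n) =>
        W.card ≤ k * r ∧ scopeWeight M₁ M₂ W ≤ β * r,
      ((univ.filter fun ω : Fin (Δ * n) → (Fin k ↪ Fin n) =>
        ∀ j ∈ S, ∀ i, ω j i ∈ W).card : ℝ) ≤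
      Real.exp (3 + Cu) ^ r * (x ^ (-(β * r)) * ((k * x) ^ (k * r) * N)) := by
    intro S hS
    have hSr : S.card = r := (mem_powersetCard.1 hS).2
    calc _ ≤ ∑ W ∈ univ.filter fun W : Finset (Fin n) =>
            W.card ≤ k * r ∧ scopeWeight M₁ M₂ W ≤ β * r,
            x ^ scopeWeight M₁ M₂ W * (x ^ (-(β * r)) * ((k * x) ^ (k * r) * N)) := by
          refine sum_le_sum fun W hW => ?_
          obtain ⟨hWk, hWβ⟩ := (mem_filter.1 hW).2
          refine (card_filter_scopes_subset_le _ n k hn S W).trans ?_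
          rw [hSr, ← mul_assoc, ← Real.rpow_add hx]
          have hone : 1 ≤ x ^ (scopeWeight M₁ M₂ W + -(β * r)) :=
            Real.one_le_rpow_of_pos_of_le_one_of_nonpos hx hx1 (by linarith)
          have hfrac : (W.card : ℝ) / n ≤ k * x := by
            rw [hx_def, ← mul_div_assoc]
            gcongr
            exact_mod_cast hWk
          calc ((W.card : ℝ) / n) ^ (k * r) * N ≤ (k * x) ^ (k * r) * N := by gcongr
            _ ≤ _ := le_mul_of_one_le_left (by positivity) hone
      _ ≤ ∑ W : Finset (Fin n),
            x ^ scopeWeight M₁ M₂ W * (x ^ (-(β * r)) * ((k * x) ^ (k * r) * N)) :=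
          sum_le_sum_of_subset_of_nonneg (subset_univ _) fun W _ _ => by positivity
      _ ≤ _ := by
          rw [← sum_mul]
          gcongr
  have rpow_collect : x⁻¹ * x ^ (-β) * x ^ k = x ^ ((t : ℝ) / 2 - 1 - ζ') := by
    rw [← Real.rpow_neg_one, ← Real.rpow_natCast, ← Real.rpow_add hx, ← Real.rpow_add hx]
    congr 1
    rw [hβ]; ring
  have hm : ((Δ * n : ℕ) : ℝ) / r = Δ * x⁻¹ := by
    rw [hx_def]; push_cast; field_simp
  calc _ ≤ ∑ _S ∈ powersetCard r (univ : Finset (Fin (Δ * n))),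
        Real.exp (3 + Cu) ^ r * (x ^ (-(β * r)) * ((k * x) ^ (k * r) * N)) := sum_le_sum inner
    _ = ((Δ * n).choose r : ℝ) *
        (Real.exp (3 + Cu) ^ r * (x ^ (-(β * r)) * ((k * x) ^ (k * r) * N))) := by
        rw [sum_const, card_powersetCard, card_univ, Fintype.card_fin, nsmul_eq_mul]
    _ ≤ (Real.exp 1 * (((Δ * n : ℕ) : ℝ) / r)) ^ r *
        (Real.exp (3 + Cu) ^ r * (x ^ (-(β * r)) * ((k * x) ^ (k * r) * N))) := by
        gcongr
        exact choose_le_exp_mul_div_pow _ _ hr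
    _ = (k ^ k * Real.exp (4 + Cu) * (Δ * x ^ ((t : ℝ) / 2 - 1 - ζ'))) ^ r * N := by
        rw [hm, ← rpow_collect, ← neg_mul, Real.rpow_mul hx.le, Real.rpow_natCast, pow_mul,
          show (4 : ℝ) + Cu = 1 + (3 + Cu) by ring, Real.exp_add 1]
        simp only [mul_pow]
        ring
    _ ≤ _ := by gcongr

lemma sum_half_pow_le (p : ℝ) (hp₀ : 0 ≤ p) (hp : p ≤ 1) (m : ℕ) :
    ∑ r ∈ Icc 1 m, (p / 2) ^ r ≤ p := by
  have geom : ∀ m : ℕ, ∑ r ∈ Icc 1 m, (1 / 2 : ℝ) ^ r = 1 - (1 / 2) ^ m := by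
    intro m
    induction m with
    | zero => simp
    | succ m ih => rw [sum_Icc_succ_top (by omega), ih, pow_succ]; ring
  calc ∑ r ∈ Icc 1 m, (p / 2) ^ r ≤ ∑ r ∈ Icc 1 m, p * (1 / 2) ^ r := by
        refine sum_le_sum fun r hr => ?_
        rw [div_eq_mul_one_div, mul_pow]
        gcongr
        exact pow_le_of_le_one hp₀ hp (by have := (mem_Icc.1 hr).1; omega)
    _ ≤ p := by
        rw [← mul_sum, geom]
        exact mul_le_of_le_one_right hp₀ (by linarith [pow_pos (one_half_pos (α := ℝ)) m])

lemma one_sub_le_uprob {Ω : Type} [Fintype Ω] [Nonempty Ω] (P : Ω → Prop) (B : Finset Ω) (p : ℝ)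
    (hB : ∀ ω, ω ∉ B → P ω) (hp : (B.card : ℝ) ≤ p * Fintype.card Ω) : 1 - p ≤ uprob P := by
  classical
  have hΩ : (0 : ℝ) < Fintype.card Ω := by exact_mod_cast Fintype.card_pos
  rw [uprob, le_div_iff₀ hΩ]
  have hsub : Bᶜ.card ≤ (@Finset.filter Ω P (Classical.decPred P) univ).card := by
    refine card_le_card fun ω hω => ?_
    simpa using hB ω (by simpa using hω)
  have hcompl : (B.card : ℝ) + Bᶜ.card = Fintype.card Ω := by
    exact_mod_cast card_add_card_compl B
  have : (Bᶜ.card : ℝ) ≤ (@Finset.filter Ω P (Classical.decPred P) univ).card := by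
    exact_mod_cast hsub
  linarith

/-- For small enough density, either there are no random constraints or `k ≤ n`. -/
lemma nonempty_scopes (t k n Δ SMALL : ℕ) (c γ : ℝ) (hc₀ : 0 ≤ c)
    (hc : c * (k : ℝ) ^ t < 1) (hγ : γ ≤ t) (hS : 1 ≤ SMALL) (hSn : SMALL ≤ n)
    (hΔ : (Δ : ℝ) ≤ c * ((n : ℝ) / SMALL) ^ γ) :
    Nonempty (Fin (Δ * n) → (Fin k ↪ Fin n)) := by
  rcases le_or_gt k n with hkn | hkn
  · exact ⟨fun _ => Fin.castLEEmb hkn⟩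
  · have hS' : (1 : ℝ) ≤ SMALL := by exact_mod_cast hS
    have hbase : 1 ≤ (n : ℝ) / SMALL := (one_le_div (by linarith)).2 (by exact_mod_cast hSn)
    have hbase' : (n : ℝ) / SMALL ≤ k :=
      (div_le_self (Nat.cast_nonneg n) hS').trans (by exact_mod_cast hkn.le)
    have hpow : ((n : ℝ) / SMALL) ^ γ ≤ (k : ℝ) ^ t :=
      calc ((n : ℝ) / SMALL) ^ γ ≤ ((n : ℝ) / SMALL) ^ (t : ℝ) :=
            Real.rpow_le_rpow_of_exponent_le hbase hγ
        _ ≤ (k : ℝ) ^ t := by rw [Real.rpow_natCast]; gcongr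
    have hΔ1 : (Δ : ℝ) < 1 := (hΔ.trans (by gcongr)).trans_lt hc
    have hΔ0 : Δ = 0 := by
      have : Δ < 1 := by exact_mod_cast hΔ1
      omega
    have : IsEmpty (Fin (Δ * n)) := by rw [hΔ0, zero_mul]; infer_instance
    exact ⟨isEmptyElim⟩

/-- expansion of a random factor graph with an added deterministic matching `M₂`
and a deterministic set `M₁` (of cardinality ≤ U) of unary constraints.  Only the graph
structure of the instance matters here. -/
theorem stmt4 (t k : ℕ) (Cu : ℝ) (ht : 3 ≤ t) (hk : 0 < k) (hCu : 0 < Cu) :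
    ∃ κ₀ : ℝ, 0 < κ₀ ∧
      ∀ (n Δ U SMALL : ℕ) (p ζ : ℝ)
        (M₁ : Finset (Fin n)) (M₂ : Finset (Fin n × Fin n)),
        (U : ℝ) ≤ Cu * Real.sqrt (n : ℝ) →
        0 < p → p < 1 / 2 →
        0 < ζ → ζ ≤ 1 / 2 →
        1 ≤ SMALL → SMALL ≤ n →
        -- the unary scopes `M₁` and the matching scopes `M₂` are pairwise disjoint and
        -- their union partitions [n]
        M₁.card ≤ U →
        (M₁ ∪ M₂.biUnion fun e => {e.1, e.2}) = Finset.univ →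
        M₁.card + 2 * M₂.card = n →
        -- the density bound, with ζ' = (k+1)ζ
        (Δ : ℝ) ≤ κ₀ * p * ((n : ℝ) / (SMALL : ℝ)) ^ ((t : ℝ) / 2 - 1 - ((k : ℝ) + 1) * ζ) →
        1 - p ≤
          uprob (fun ω : Fin (Δ * n) → (Fin k ↪ Fin n) =>
            -- every nonempty constraint-induced subgraph with at most SMALL constraints
            -- satisfies v(H) ≥ e(H) - T(H)/2 + ζ·c(H)
            ∀ (Cr : Finset (Fin (Δ * n))) (C1 : Finset (Fin n))
              (C2 : Finset (Fin n × Fin n)),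
              C1 ⊆ M₁ → C2 ⊆ M₂ →
              (Cr.Nonempty ∨ C1.Nonempty ∨ C2.Nonempty) →
              Cr.card + C1.card + C2.card ≤ SMALL →
              ((((Cr.biUnion fun j => Finset.univ.image (ω j)) ∪ C1 ∪
                  C2.biUnion fun e => {e.1, e.2}).card : ℝ))
                ≥ ((k * Cr.card + C1.card + 2 * C2.card : ℕ) : ℝ)
                    - ((t * Cr.card + C1.card + 2 * C2.card : ℕ) : ℝ) / 2
                    + ζ * ((Cr.card + C1.card + C2.card : ℕ) : ℝ)) := by
  have hk' : (1 : ℝ) ≤ k := by exact_mod_cast hk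
  set K : ℝ := k ^ k * Real.exp (4 + Cu)
  have hK1 : 1 ≤ K :=
    one_le_mul_of_one_le_of_one_le (one_le_pow₀ hk') (Real.one_le_exp (by linarith))
  have hkt : 1 ≤ (k : ℝ) ^ t := one_le_pow₀ hk'
  refine ⟨1 / (2 * K * k ^ t), by positivity, ?_⟩
  intro n Δ U SMALL p ζ M₁ M₂ hU hp₀ hp hζ₀ hζ hS hSn hM₁ hcover hcard hΔ
  set c : ℝ := 1 / (2 * K * k ^ t) * p with hc
  have hc₀ : 0 ≤ c := by positivity
  have hc_kt : c * (k : ℝ) ^ t = p / (2 * K) := by rw [hc]; field_simp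
  have hKc : K * c ≤ p / 2 := by
    rw [hc, show K * (1 / (2 * K * (k : ℝ) ^ t) * p) = p / 2 / (k : ℝ) ^ t by field_simp]
    exact div_le_self (by positivity) hkt
  have hc_kt_lt : c * (k : ℝ) ^ t < 1 := by
    rw [hc_kt, div_lt_one (by positivity)]; linarith
  have hc1 : c < 1 := (le_mul_of_one_le_right hc₀ hkt).trans_lt hc_kt_lt
  have hM₁' : (M₁.card : ℝ) ≤ Cu * √(n : ℝ) := le_trans (by exact_mod_cast hM₁) hU
  have hγ : (t : ℝ) / 2 - 1 - ((k : ℝ) + 1) * ζ ≤ t := by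
    have : 0 ≤ ((k : ℝ) + 1) * ζ := by positivity
    have : (0 : ℝ) ≤ t := Nat.cast_nonneg t
    linarith
  have hnonempty := nonempty_scopes t k n Δ SMALL c _ hc₀ hc_kt_lt hγ hS hSn hΔ
  let bad : Finset (Fin (Δ * n) → (Fin k ↪ Fin n)) :=
    (Icc 1 SMALL).biUnion fun r =>
      (powersetCard r univ).biUnion fun S =>
        (univ.filter fun W : Finset (Fin n) => W.card ≤ k * r ∧
          scopeWeight M₁ M₂ W ≤ ((k : ℝ) - t / 2 + ((k : ℝ) + 1) * ζ) * r).biUnion fun W =>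
            univ.filter fun ω => ∀ j ∈ S, ∀ i, ω j i ∈ W
  refine one_sub_le_uprob _ bad p ?_ ?_
  · intro ω hω Cr C₁ C₂ hC₁ hC₂ _ hsmall
    by_contra hlt
    push Not at hlt
    apply hω
    set W : Finset (Fin n) := Cr.biUnion fun j => univ.image (ω j) with hW
    have hWcard : W.card ≤ k * Cr.card := by
      rw [mul_comm]
      exact card_biUnion_le_card_mul _ _ _ fun j _ => card_image_le.trans (by simp)
    have hweight := scopeWeight_le M₁ M₂ hcover (by simpa using hcard) W C₁ C₂ hC₁ hC₂ ζ hζ₀.le hζ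
    push_cast at hlt
    have hWcard' : ζ * (W.card : ℝ) ≤ ζ * (k * Cr.card) := by
      gcongr
      exact_mod_cast hWcard
    have hweight_lt :
        scopeWeight M₁ M₂ W < ((k : ℝ) - t / 2 + ((k : ℝ) + 1) * ζ) * Cr.card := by
      nlinarith
    have hCr : 1 ≤ Cr.card := by
      by_contra h0
      have h0 : Cr.card = 0 := by omega
      have : 0 ≤ scopeWeight M₁ M₂ W :=
        add_nonneg (sum_nonneg fun _ _ => by split_ifs <;> norm_num)
          (sum_nonneg fun _ _ => by split_ifs <;> norm_num)
      simp only [h0, Nat.cast_zero, mul_zero] at hweight_lt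
      linarith
    simp only [bad, mem_biUnion, mem_Icc, mem_powersetCard, mem_filter]
    refine ⟨Cr.card, ⟨hCr, by omega⟩, Cr, ⟨subset_univ _, rfl⟩, W,
      ⟨mem_univ _, hWcard, hweight_lt.le⟩, mem_univ _, fun j hj i => ?_⟩
    exact mem_biUnion.2 ⟨j, hj, mem_image_of_mem _ (mem_univ i)⟩
  · set N : ℝ := (Fintype.card (Fin (Δ * n) → (Fin k ↪ Fin n)) : ℝ)
    calc (bad.card : ℝ)
        ≤ ∑ r ∈ Icc 1 SMALL, ∑ S ∈ powersetCard r (univ : Finset (Fin (Δ * n))),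
            ∑ W ∈ univ.filter fun W : Finset (Fin n) => W.card ≤ k * r ∧
              scopeWeight M₁ M₂ W ≤ ((k : ℝ) - t / 2 + ((k : ℝ) + 1) * ζ) * r,
            ((univ.filter fun ω : Fin (Δ * n) → (Fin k ↪ Fin n) =>
              ∀ j ∈ S, ∀ i, ω j i ∈ W).card : ℝ) := by
          simp only [← Nat.cast_sum]
          exact Nat.cast_le.2 <| card_biUnion_le.trans (sum_le_sum fun r _ =>
            card_biUnion_le.trans (sum_le_sum fun S _ => card_biUnion_le))
      _ ≤ ∑ r ∈ Icc 1 SMALL, (p / 2) ^ r * N := by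
          refine sum_le_sum fun r hr => ?_
          obtain ⟨hr1, hrS⟩ := mem_Icc.1 hr
          refine (sum_card_filter_scopes_subset_le t k n Δ r Cu _ c hCu.le M₁ M₂ hM₁' hcover hcard
            hr1 (hrS.trans hSn)
            (density_mul_rpow_le n SMALL r Δ c _ hc₀ hc1 hr1 hrS hSn hΔ)).trans ?_
          gcongr
      _ ≤ p * N := by
          rw [← sum_mul]
          gcongr
          exact sum_half_pow_le p hp₀.le (by linarith) SMALL
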